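/- arXiv:1710.02739 — 6 statements merged into one kernel-verified Lean document; each statement's English description precedes it below -/
import Mathlib

section
/- Let s ∈ {1,−1}, let p be a positive integer, and let v : ℝ³ → ℝ be a smooth function of (t,x,y) solving the gKP potential equation v_{tx} + (v_x)^p v_{xx} + v_{xxxx} + s·v_{yy} = 0 at every point. Define the functions of (t,x,y): T = (1/2)v_{xx}² − (1/2)s·v_y² − v_x^{p+2}/((p+1)(p+2)), X = v_t·v_{xxx} − v_{tx}·v_{xx} + v_x^{p+1}·v_t/(p+1) + (1/2)v_t², Y = s·v_t·v_y. Then the local conservation law ∂_t T + ∂_x X + ∂_y Y = 0 holds at every point (this is the energy conservation law of the gKP equation, arising from time-translation invariance). -/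
/-- Partial derivative with respect to the first (time) variable. -/
noncomputable def pdt (v : ℝ → ℝ → ℝ → ℝ) (t x y : ℝ) : ℝ :=
  deriv (fun t' => v t' x y) t

/-- Partial derivative with respect to the second (x) variable. -/
noncomputable def pdx (v : ℝ → ℝ → ℝ → ℝ) (t x y : ℝ) : ℝ :=
  deriv (fun x' => v t x' y) x

/-- Partial derivative with respect to the third (y) variable. -/
noncomputable def pdy (v : ℝ → ℝ → ℝ → ℝ) (t x y : ℝ) : ℝ :=
  deriv (fun y' => v t x y') y

/-- Joint smoothness of a curried function of three real variables. -/
def SmoothCurried (v : ℝ → ℝ → ℝ → ℝ) : Prop :=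
  ContDiff ℝ (⊤ : ℕ∞) (fun q : ℝ × ℝ × ℝ => v q.1 q.2.1 q.2.2)

/-- Second directional derivatives of a smooth function commute. -/
theorem fderiv_fderiv_apply_comm {E : Type*} [NormedAddCommGroup E] [NormedSpace ℝ E]
    {F : E → ℝ} (hF : ContDiff ℝ (⊤ : ℕ∞) F) (q a b : E) :
    fderiv ℝ (fun z => fderiv ℝ F z a) q b = fderiv ℝ (fun z => fderiv ℝ F z b) q a := by
  have hd : DifferentiableAt ℝ (fderiv ℝ F) q :=
    ((hF.fderiv_right (m := 1) (by norm_cast)).differentiable (by norm_num)) q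
  have key (c d : E) : fderiv ℝ (fun z => fderiv ℝ F z c) q d = fderiv ℝ (fderiv ℝ F) q d c := by
    simp [fderiv_clm_apply hd (differentiableAt_const c)]
  rw [key, key]
  refine (hF.contDiffAt.isSymmSndFDerivAt ?_).eq b a
  simp only [minSmoothness_of_isRCLikeNormedField]
  exact WithTop.coe_le_coe.2 le_top

namespace SmoothCurried

variable {v : ℝ → ℝ → ℝ → ℝ}

theorem hasDerivAt_fderiv_t (hv : SmoothCurried v) (t x y : ℝ) :
    HasDerivAt (fun t' => v t' x y)
      (fderiv ℝ (fun q : ℝ × ℝ × ℝ => v q.1 q.2.1 q.2.2) (t, x, y) (1, 0, 0)) t :=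
  HasFDerivAt.comp_hasDerivAt (f := fun t' => (t', x, y)) t
    (ContDiff.differentiable hv (by simp) (t, x, y)).hasFDerivAt
    ((hasDerivAt_id' t).prodMk (hasDerivAt_const t (x, y)))

theorem pdt_eq_fderiv (hv : SmoothCurried v) (t x y : ℝ) :
    pdt v t x y = fderiv ℝ (fun q : ℝ × ℝ × ℝ => v q.1 q.2.1 q.2.2) (t, x, y) (1, 0, 0) :=
  (hv.hasDerivAt_fderiv_t t x y).deriv

theorem hasDerivAt_t (hv : SmoothCurried v) (t x y : ℝ) :
    HasDerivAt (fun t' => v t' x y) (pdt v t x y) t :=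
  (hv.hasDerivAt_fderiv_t t x y).differentiableAt.hasDerivAt

protected theorem pdt (hv : SmoothCurried v) : SmoothCurried (pdt v) := by
  simp only [SmoothCurried, hv.pdt_eq_fderiv]
  exact (ContDiff.fderiv_right hv (by norm_cast)).clm_apply contDiff_const

theorem hasDerivAt_fderiv_x (hv : SmoothCurried v) (t x y : ℝ) :
    HasDerivAt (fun x' => v t x' y)
      (fderiv ℝ (fun q : ℝ × ℝ × ℝ => v q.1 q.2.1 q.2.2) (t, x, y) (0, 1, 0)) x :=
  HasFDerivAt.comp_hasDerivAt (f := fun x' => (t, x', y)) x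
    (ContDiff.differentiable hv (by simp) (t, x, y)).hasFDerivAt
    ((hasDerivAt_const x t).prodMk ((hasDerivAt_id' x).prodMk (hasDerivAt_const x y)))

theorem pdx_eq_fderiv (hv : SmoothCurried v) (t x y : ℝ) :
    pdx v t x y = fderiv ℝ (fun q : ℝ × ℝ × ℝ => v q.1 q.2.1 q.2.2) (t, x, y) (0, 1, 0) :=
  (hv.hasDerivAt_fderiv_x t x y).deriv

theorem hasDerivAt_x (hv : SmoothCurried v) (t x y : ℝ) :
    HasDerivAt (fun x' => v t x' y) (pdx v t x y) x :=
  (hv.hasDerivAt_fderiv_x t x y).differentiableAt.hasDerivAt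

protected theorem pdx (hv : SmoothCurried v) : SmoothCurried (pdx v) := by
  simp only [SmoothCurried, hv.pdx_eq_fderiv]
  exact (ContDiff.fderiv_right hv (by norm_cast)).clm_apply contDiff_const

theorem hasDerivAt_fderiv_y (hv : SmoothCurried v) (t x y : ℝ) :
    HasDerivAt (fun y' => v t x y')
      (fderiv ℝ (fun q : ℝ × ℝ × ℝ => v q.1 q.2.1 q.2.2) (t, x, y) (0, 0, 1)) y :=
  HasFDerivAt.comp_hasDerivAt (f := fun y' => (t, x, y')) y
    (ContDiff.differentiable hv (by simp) (t, x, y)).hasFDerivAt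
    ((hasDerivAt_const y t).prodMk ((hasDerivAt_const y x).prodMk (hasDerivAt_id' y)))

theorem pdy_eq_fderiv (hv : SmoothCurried v) (t x y : ℝ) :
    pdy v t x y = fderiv ℝ (fun q : ℝ × ℝ × ℝ => v q.1 q.2.1 q.2.2) (t, x, y) (0, 0, 1) :=
  (hv.hasDerivAt_fderiv_y t x y).deriv

theorem hasDerivAt_y (hv : SmoothCurried v) (t x y : ℝ) :
    HasDerivAt (fun y' => v t x y') (pdy v t x y) y :=
  (hv.hasDerivAt_fderiv_y t x y).differentiableAt.hasDerivAt

protected theorem pdy (hv : SmoothCurried v) : SmoothCurried (pdy v) := by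
  simp only [SmoothCurried, hv.pdy_eq_fderiv]
  exact (ContDiff.fderiv_right hv (by norm_cast)).clm_apply contDiff_const

theorem pdx_pdt_comm (hv : SmoothCurried v) (t x y : ℝ) :
    pdx (pdt v) t x y = pdt (pdx v) t x y := by
  rw [hv.pdt.pdx_eq_fderiv, hv.pdx.pdt_eq_fderiv]
  simp only [hv.pdt_eq_fderiv, hv.pdx_eq_fderiv]
  exact fderiv_fderiv_apply_comm hv _ _ _

theorem pdy_pdt_comm (hv : SmoothCurried v) (t x y : ℝ) :
    pdy (pdt v) t x y = pdt (pdy v) t x y := by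
  rw [hv.pdt.pdy_eq_fderiv, hv.pdy.pdt_eq_fderiv]
  simp only [hv.pdt_eq_fderiv, hv.pdy_eq_fderiv]
  exact fderiv_fderiv_apply_comm hv _ _ _

end SmoothCurried

/-- Energy conservation law of the gKP equation. -/
theorem gkp_energy_conservation
    (s : ℝ) (hs : s = 1 ∨ s = -1)
    (p : ℕ) (hp : 1 ≤ p)
    (v : ℝ → ℝ → ℝ → ℝ)
    (hv : ContDiff ℝ (⊤ : ℕ∞) (fun q : ℝ × ℝ × ℝ => v q.1 q.2.1 q.2.2))
    (hsol : ∀ t x y : ℝ,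
      pdt (pdx v) t x y + (pdx v t x y) ^ p * pdx (pdx v) t x y
        + pdx (pdx (pdx (pdx v))) t x y + s * pdy (pdy v) t x y = 0)
    (T X Y : ℝ → ℝ → ℝ → ℝ)
    (hT : ∀ t x y : ℝ, T t x y =
      (1/2) * (pdx (pdx v) t x y) ^ 2 - (1/2) * s * (pdy v t x y) ^ 2
        - (pdx v t x y) ^ (p+2) / (((p : ℝ) + 1) * ((p : ℝ) + 2)))
    (hX : ∀ t x y : ℝ, X t x y =
      pdt v t x y * pdx (pdx (pdx v)) t x y
        - pdt (pdx v) t x y * pdx (pdx v) t x y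
        + (pdx v t x y) ^ (p+1) * pdt v t x y / ((p : ℝ) + 1)
        + (1/2) * (pdt v t x y) ^ 2)
    (hY : ∀ t x y : ℝ, Y t x y = s * pdt v t x y * pdy v t x y) :
    ∀ t x y : ℝ, pdt T t x y + pdx X t x y + pdy Y t x y = 0 := by
  have sv : SmoothCurried v := hv
  intro t x y
  have hp1 : (p : ℝ) + 1 ≠ 0 := by positivity
  have hp2 : (p : ℝ) + 2 ≠ 0 := by positivity
  have hTt : pdt T t x y = pdx (pdx v) t x y * pdt (pdx (pdx v)) t x y
      - s * pdy v t x y * pdt (pdy v) t x y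
      - pdx v t x y ^ (p + 1) * pdt (pdx v) t x y / (p + 1) := by
    rw [pdt]
    simp only [hT]
    refine HasDerivAt.deriv ?_
    convert ((((sv.pdx.pdx.hasDerivAt_t t x y).fun_pow 2).const_mul (1 / 2)).fun_sub
      (((sv.pdy.hasDerivAt_t t x y).fun_pow 2).const_mul ((1 / 2) * s))).fun_sub
      (((sv.pdx.hasDerivAt_t t x y).fun_pow (p + 2)).div_const
        (((p : ℝ) + 1) * (p + 2))) using 1
    simp only [show p + 2 - 1 = p + 1 from rfl]
    push_cast
    field_simp
  have hXx : pdx X t x y = pdx (pdt v) t x y * pdx (pdx (pdx v)) t x y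
      + pdt v t x y * pdx (pdx (pdx (pdx v))) t x y
      - pdx (pdt (pdx v)) t x y * pdx (pdx v) t x y
      - pdt (pdx v) t x y * pdx (pdx (pdx v)) t x y
      + pdx v t x y ^ p * pdx (pdx v) t x y * pdt v t x y
      + pdx v t x y ^ (p + 1) * pdx (pdt v) t x y / (p + 1)
      + pdt v t x y * pdx (pdt v) t x y := by
    rw [pdx]
    simp only [hX]
    refine HasDerivAt.deriv ?_
    convert ((((sv.pdt.hasDerivAt_x t x y).fun_mul (sv.pdx.pdx.pdx.hasDerivAt_x t x y)).fun_sub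
      ((sv.pdx.pdt.hasDerivAt_x t x y).fun_mul (sv.pdx.pdx.hasDerivAt_x t x y))).fun_add
      ((((sv.pdx.hasDerivAt_x t x y).fun_pow (p + 1)).fun_mul
        (sv.pdt.hasDerivAt_x t x y)).div_const ((p : ℝ) + 1))).fun_add
      (((sv.pdt.hasDerivAt_x t x y).fun_pow 2).const_mul (1 / 2)) using 1
    simp only [Nat.add_sub_cancel]
    push_cast
    field_simp
    ring
  have hYy : pdy Y t x y =
      s * pdy (pdt v) t x y * pdy v t x y + s * pdt v t x y * pdy (pdy v) t x y := by
    rw [pdy]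
    simp only [hY]
    exact (((sv.pdt.hasDerivAt_y t x y).const_mul s).fun_mul (sv.pdy.hasDerivAt_y t x y)).deriv
  rw [hTt, hXx, hYy, sv.pdx_pdt_comm, sv.pdx.pdx_pdt_comm, sv.pdy_pdt_comm]
  linear_combination pdt v t x y * hsol t x y
end

section
/- Let s ∈ {1,−1}, let p be a positive integer, and let v : ℝ³ → ℝ be a smooth function of (t,x,y) solving the gKP potential equation v_{tx} + (v_x)^p v_{xx} + v_{xxxx} + s·v_{yy} = 0 at every point. Define T = (1/2)y·v_x² − s·t·v_y·v_x, X = (y·v_x − 2s·t·v_y)·v_{xxx} − (1/2)y·v_{xx}² + 2s·t·v_{xy}·v_{xx} − (1/2)s·y·v_y² − s·t·v_y·v_t − 2s·t·v_y·v_x^{p+1}/(p+1) + y·v_x^{p+2}/(p+2), Y = −s·t·v_{xx}² − t·v_y² + s·y·v_y·v_x + s·t·v_t·v_x + 2s·t·v_x^{p+2}/((p+1)(p+2)). Then ∂_t T + ∂_x X + ∂_y Y = 0 at every point (this is the conservation law arising from the rotation-boost point symmetry of the gKP equation). -/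
/-- Joint smoothness of a curried function of `(t, x, y)`. -/
def SmoothField (v : ℝ → ℝ → ℝ → ℝ) : Prop :=
  ContDiff ℝ (⊤ : ℕ∞) (fun q : ℝ × ℝ × ℝ => v q.1 q.2.1 q.2.2)

namespace SmoothField

variable {v : ℝ → ℝ → ℝ → ℝ}

theorem hasFDerivAt (hv : SmoothField v) (q : ℝ × ℝ × ℝ) :
    HasFDerivAt (fun q : ℝ × ℝ × ℝ => v q.1 q.2.1 q.2.2)
      (fderiv ℝ (fun q : ℝ × ℝ × ℝ => v q.1 q.2.1 q.2.2) q) q :=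
  ((ContDiff.differentiable hv (by simp)) q).hasFDerivAt

theorem hasDerivAt_fderiv_t (hv : SmoothField v) (t x y : ℝ) :
    HasDerivAt (fun t' => v t' x y)
      (fderiv ℝ (fun q : ℝ × ℝ × ℝ => v q.1 q.2.1 q.2.2) (t, x, y) (1, 0, 0)) t :=
  HasFDerivAt.comp_hasDerivAt (f := fun t' => (t', x, y)) t
    (hv.hasFDerivAt (t, x, y))
    ((hasDerivAt_id t).prodMk ((hasDerivAt_const t x).prodMk (hasDerivAt_const t y)))

theorem hasDerivAt_fderiv_x (hv : SmoothField v) (t x y : ℝ) :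
    HasDerivAt (fun x' => v t x' y)
      (fderiv ℝ (fun q : ℝ × ℝ × ℝ => v q.1 q.2.1 q.2.2) (t, x, y) (0, 1, 0)) x :=
  HasFDerivAt.comp_hasDerivAt (f := fun x' => (t, x', y)) x
    (hv.hasFDerivAt (t, x, y))
    ((hasDerivAt_const x t).prodMk ((hasDerivAt_id x).prodMk (hasDerivAt_const x y)))

theorem hasDerivAt_fderiv_y (hv : SmoothField v) (t x y : ℝ) :
    HasDerivAt (fun y' => v t x y')
      (fderiv ℝ (fun q : ℝ × ℝ × ℝ => v q.1 q.2.1 q.2.2) (t, x, y) (0, 0, 1)) y :=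
  HasFDerivAt.comp_hasDerivAt (f := fun y' => (t, x, y')) y
    (hv.hasFDerivAt (t, x, y))
    ((hasDerivAt_const y t).prodMk ((hasDerivAt_const y x).prodMk (hasDerivAt_id y)))

theorem pdt_eq (hv : SmoothField v) (t x y : ℝ) : pdt v t x y =
    fderiv ℝ (fun q : ℝ × ℝ × ℝ => v q.1 q.2.1 q.2.2) (t, x, y) (1, 0, 0) :=
  (hv.hasDerivAt_fderiv_t t x y).deriv

theorem hasDerivAt_t (hv : SmoothField v) (t x y : ℝ) :
    HasDerivAt (fun t' => v t' x y) (pdt v t x y) t :=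
  (hv.hasDerivAt_fderiv_t t x y).differentiableAt.hasDerivAt

theorem pdx_eq (hv : SmoothField v) (t x y : ℝ) : pdx v t x y =
    fderiv ℝ (fun q : ℝ × ℝ × ℝ => v q.1 q.2.1 q.2.2) (t, x, y) (0, 1, 0) :=
  (hv.hasDerivAt_fderiv_x t x y).deriv

theorem hasDerivAt_x (hv : SmoothField v) (t x y : ℝ) :
    HasDerivAt (fun x' => v t x' y) (pdx v t x y) x :=
  (hv.hasDerivAt_fderiv_x t x y).differentiableAt.hasDerivAt

theorem pdy_eq (hv : SmoothField v) (t x y : ℝ) : pdy v t x y =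
    fderiv ℝ (fun q : ℝ × ℝ × ℝ => v q.1 q.2.1 q.2.2) (t, x, y) (0, 0, 1) :=
  (hv.hasDerivAt_fderiv_y t x y).deriv

theorem hasDerivAt_y (hv : SmoothField v) (t x y : ℝ) :
    HasDerivAt (fun y' => v t x y') (pdy v t x y) y :=
  (hv.hasDerivAt_fderiv_y t x y).differentiableAt.hasDerivAt

theorem contDiff_fderiv_apply (hv : SmoothField v) (e : ℝ × ℝ × ℝ) :
    ContDiff ℝ (⊤ : ℕ∞)
      (fun q => fderiv ℝ (fun q : ℝ × ℝ × ℝ => v q.1 q.2.1 q.2.2) q e) :=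
  (ContDiff.fderiv_right hv (by simp)).clm_apply contDiff_const

protected theorem pdt (hv : SmoothField v) : SmoothField (pdt v) := by
  have h := hv.contDiff_fderiv_apply (1, 0, 0)
  simpa only [SmoothField, hv.pdt_eq] using h

protected theorem pdx (hv : SmoothField v) : SmoothField (pdx v) := by
  have h := hv.contDiff_fderiv_apply (0, 1, 0)
  simpa only [SmoothField, hv.pdx_eq] using h

protected theorem pdy (hv : SmoothField v) : SmoothField (pdy v) := by
  have h := hv.contDiff_fderiv_apply (0, 0, 1)
  simpa only [SmoothField, hv.pdy_eq] using h

theorem fderiv_fderiv_apply_comm (hv : SmoothField v) (q e f : ℝ × ℝ × ℝ) :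
    fderiv ℝ (fun q => fderiv ℝ (fun q : ℝ × ℝ × ℝ => v q.1 q.2.1 q.2.2) q e) q f =
      fderiv ℝ (fun q => fderiv ℝ (fun q : ℝ × ℝ × ℝ => v q.1 q.2.1 q.2.2) q f) q e := by
  have hd : DifferentiableAt ℝ (fderiv ℝ (fun q : ℝ × ℝ × ℝ => v q.1 q.2.1 q.2.2)) q :=
    (ContDiff.fderiv_right (m := 1) hv (by norm_cast)).differentiable (by simp) q
  have hs : IsSymmSndFDerivAt ℝ (fun q : ℝ × ℝ × ℝ => v q.1 q.2.1 q.2.2) q :=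
    (ContDiff.contDiffAt hv).isSymmSndFDerivAt (by simp; norm_cast)
  rw [fderiv_clm_apply hd (differentiableAt_const e),
    fderiv_clm_apply hd (differentiableAt_const f)]
  simpa using hs f e

theorem pdx_pdy_comm (hv : SmoothField v) : pdx (pdy v) = pdy (pdx v) := by
  funext t x y
  rw [hv.pdy.pdx_eq, hv.pdx.pdy_eq]
  simp only [hv.pdx_eq, hv.pdy_eq]
  exact hv.fderiv_fderiv_apply_comm _ _ _

theorem pdx_pdt_comm (hv : SmoothField v) : pdx (pdt v) = pdt (pdx v) := by
  funext t x y
  rw [hv.pdt.pdx_eq, hv.pdx.pdt_eq]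
  simp only [hv.pdx_eq, hv.pdt_eq]
  exact hv.fderiv_fderiv_apply_comm _ _ _

theorem pdt_pdy_comm (hv : SmoothField v) : pdt (pdy v) = pdy (pdt v) := by
  funext t x y
  rw [hv.pdy.pdt_eq, hv.pdt.pdy_eq]
  simp only [hv.pdt_eq, hv.pdy_eq]
  exact hv.fderiv_fderiv_apply_comm _ _ _

end SmoothField

/-- Conservation law of the gKP equation arising from the rotation-boost symmetry. -/
theorem gkp_rotation_boost_conservation
    (s : ℝ) (hs : s = 1 ∨ s = -1)
    (p : ℕ) (hp : 1 ≤ p)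
    (v : ℝ → ℝ → ℝ → ℝ)
    (hv : ContDiff ℝ (⊤ : ℕ∞) (fun q : ℝ × ℝ × ℝ => v q.1 q.2.1 q.2.2))
    (hsol : ∀ t x y : ℝ,
      pdt (pdx v) t x y + (pdx v t x y) ^ p * pdx (pdx v) t x y
        + pdx (pdx (pdx (pdx v))) t x y + s * pdy (pdy v) t x y = 0)
    (T X Y : ℝ → ℝ → ℝ → ℝ)
    (hT : ∀ t x y : ℝ, T t x y =
      (1/2) * y * (pdx v t x y) ^ 2 - s * t * pdy v t x y * pdx v t x y)
    (hX : ∀ t x y : ℝ, X t x y =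
      (y * pdx v t x y - 2 * s * t * pdy v t x y) * pdx (pdx (pdx v)) t x y
        - (1/2) * y * (pdx (pdx v) t x y) ^ 2
        + 2 * s * t * pdy (pdx v) t x y * pdx (pdx v) t x y
        - (1/2) * s * y * (pdy v t x y) ^ 2
        - s * t * pdy v t x y * pdt v t x y
        - 2 * s * t * pdy v t x y * (pdx v t x y) ^ (p+1) / ((p : ℝ) + 1)
        + y * (pdx v t x y) ^ (p+2) / ((p : ℝ) + 2))
    (hY : ∀ t x y : ℝ, Y t x y =
      - s * t * (pdx (pdx v) t x y) ^ 2 - t * (pdy v t x y) ^ 2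
        + s * y * pdy v t x y * pdx v t x y
        + s * t * pdt v t x y * pdx v t x y
        + 2 * s * t * (pdx v t x y) ^ (p+2) / (((p : ℝ) + 1) * ((p : ℝ) + 2))) :
    ∀ t x y : ℝ, pdt T t x y + pdx X t x y + pdy Y t x y = 0 := by
  intro t x y
  have hv₀ : SmoothField v := hv
  have hp₁ : (p : ℝ) + 1 ≠ 0 := by positivity
  have hp₂ : (p : ℝ) + 2 ≠ 0 := by positivity
  have hTt : pdt T t x y = y * pdx v t x y * pdt (pdx v) t x y
      - s * pdy v t x y * pdx v t x y
      - s * t * (pdt (pdy v) t x y * pdx v t x y + pdy v t x y * pdt (pdx v) t x y) := by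
    have ux := hv₀.pdx.hasDerivAt_t t x y
    have uy := hv₀.pdy.hasDerivAt_t t x y
    have key := ((ux.pow 2).const_mul ((1/2) * y)).sub
      ((((hasDerivAt_id t).const_mul s).mul uy).mul ux)
    have he : (fun t' => T t' x y) = _ := funext fun t' => hT t' x y
    rw [pdt, he]
    refine (key.congr_deriv ?_).deriv
    simp
    ring
  have hXx : pdx X t x y =
      (y * pdx (pdx v) t x y - 2 * s * t * pdy (pdx v) t x y) * pdx (pdx (pdx v)) t x y
      + (y * pdx v t x y - 2 * s * t * pdy v t x y) * pdx (pdx (pdx (pdx v))) t x y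
      - y * pdx (pdx v) t x y * pdx (pdx (pdx v)) t x y
      + 2 * s * t * (pdy (pdx (pdx v)) t x y * pdx (pdx v) t x y
        + pdy (pdx v) t x y * pdx (pdx (pdx v)) t x y)
      - s * y * pdy v t x y * pdy (pdx v) t x y
      - s * t * (pdy (pdx v) t x y * pdt v t x y + pdy v t x y * pdt (pdx v) t x y)
      - 2 * s * t * pdy (pdx v) t x y * pdx v t x y ^ (p + 1) / ((p : ℝ) + 1)
      - 2 * s * t * pdy v t x y * pdx v t x y ^ p * pdx (pdx v) t x y
      + y * pdx v t x y ^ (p + 1) * pdx (pdx v) t x y := by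
    have ux := hv₀.pdx.hasDerivAt_x t x y
    have uxx := hv₀.pdx.pdx.hasDerivAt_x t x y
    have uxxx := hv₀.pdx.pdx.pdx.hasDerivAt_x t x y
    have uy := hv₀.pdy.hasDerivAt_x t x y
    have ut := hv₀.pdt.hasDerivAt_x t x y
    have uxy := hv₀.pdx.pdy.hasDerivAt_x t x y
    rw [hv₀.pdx_pdy_comm] at uy
    rw [hv₀.pdx_pdt_comm] at ut
    rw [hv₀.pdx.pdx_pdy_comm] at uxy
    have key := (((((((ux.const_mul y).sub (uy.const_mul (2 * s * t))).mul uxxx).sub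
      ((uxx.pow 2).const_mul ((1/2) * y))).add ((uxy.const_mul (2 * s * t)).mul uxx)).sub
      ((uy.pow 2).const_mul ((1/2) * s * y))).sub ((uy.const_mul (s * t)).mul ut)).sub
      (((uy.const_mul (2 * s * t)).mul (ux.pow (p + 1))).div_const ((p : ℝ) + 1)) |>.add
      (((ux.pow (p + 2)).const_mul y).div_const ((p : ℝ) + 2))
    have he : (fun x' => X t x' y) = _ := funext fun x' => hX t x' y
    rw [pdx, he]
    refine (key.congr_deriv ?_).deriv
    simp
    field_simp
    ring
  have hYy : pdy Y t x y = - 2 * s * t * pdx (pdx v) t x y * pdy (pdx (pdx v)) t x y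
      - 2 * t * pdy v t x y * pdy (pdy v) t x y + s * pdy v t x y * pdx v t x y
      + s * y * (pdy (pdy v) t x y * pdx v t x y + pdy v t x y * pdy (pdx v) t x y)
      + s * t * (pdt (pdy v) t x y * pdx v t x y + pdt v t x y * pdy (pdx v) t x y)
      + 2 * s * t * pdx v t x y ^ (p + 1) * pdy (pdx v) t x y / ((p : ℝ) + 1) := by
    have ux := hv₀.pdx.hasDerivAt_y t x y
    have uxx := hv₀.pdx.pdx.hasDerivAt_y t x y
    have uy := hv₀.pdy.hasDerivAt_y t x y
    have ut := hv₀.pdt.hasDerivAt_y t x y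
    rw [← hv₀.pdt_pdy_comm] at ut
    have key := ((((uxx.pow 2).const_mul (- s * t)).sub ((uy.pow 2).const_mul t)).add
      ((((hasDerivAt_id y).const_mul s).mul uy).mul ux)).add
      ((ut.const_mul (s * t)).mul ux) |>.add
      (((ux.pow (p + 2)).const_mul (2 * s * t)).div_const (((p : ℝ) + 1) * ((p : ℝ) + 2)))
    have he : (fun y' => Y t x y') = _ := funext fun y' => hY t x y'
    rw [pdy, he]
    refine (key.congr_deriv ?_).deriv
    simp
    field_simp
    ring
  have hs₂ : s ^ 2 = 1 := by rcases hs with rfl | rfl <;> norm_num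
  rw [hTt, hXx, hYy]
  linear_combination (y * pdx v t x y - 2 * s * t * pdy v t x y) * hsol t x y
    + 2 * t * pdy v t x y * pdy (pdy v) t x y * hs₂
end

section
/- Let s ∈ {1,−1}, let p be a positive integer, let f₁, f₂ : ℝ → ℝ be smooth functions, and let v : ℝ³ → ℝ be a smooth function of (t,x,y) solving the gKP potential equation v_{tx} + (v_x)^p v_{xx} + v_{xxxx} + s·v_{yy} = 0 at every point. Define T = 0, X = (v_x^{p+1}/(p+1) + v_{xxx} + v_t)·(f₁(t)·y + f₂(t)), Y = s·((y·v_y − v)·f₁(t) + f₂(t)·v_y). Then ∂_t T + ∂_x X + ∂_y Y = 0 at every point. (This two-parameter infinite family of conservation laws corresponds to the multiplier f₁(t)·y + f₂(t), the general solution P(t,y) of P_{yy} = 0, and yields conserved topological charges of the gKP equation.) -/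
open scoped ContDiff in
theorem hasDerivAt_slice_fst {v : ℝ → ℝ → ℝ → ℝ}
    (hv : ContDiff ℝ ∞ (fun q : ℝ × ℝ × ℝ => v q.1 q.2.1 q.2.2)) (t x y : ℝ) :
    HasDerivAt (fun t' => v t' x y)
      (fderiv ℝ (fun q : ℝ × ℝ × ℝ => v q.1 q.2.1 q.2.2) (t, x, y) (1, 0, 0)) t :=
  ((hv.differentiable (by simp) (t, x, y)).hasFDerivAt.comp_hasDerivAt t
    ((hasDerivAt_id t).prodMk ((hasDerivAt_const t x).prodMk (hasDerivAt_const t y))) :)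

open scoped ContDiff in
theorem hasDerivAt_slice_snd {v : ℝ → ℝ → ℝ → ℝ}
    (hv : ContDiff ℝ ∞ (fun q : ℝ × ℝ × ℝ => v q.1 q.2.1 q.2.2)) (t x y : ℝ) :
    HasDerivAt (fun x' => v t x' y)
      (fderiv ℝ (fun q : ℝ × ℝ × ℝ => v q.1 q.2.1 q.2.2) (t, x, y) (0, 1, 0)) x :=
  ((hv.differentiable (by simp) (t, x, y)).hasFDerivAt.comp_hasDerivAt x
    ((hasDerivAt_const x t).prodMk ((hasDerivAt_id x).prodMk (hasDerivAt_const x y))) :)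

open scoped ContDiff in
theorem hasDerivAt_slice_thd {v : ℝ → ℝ → ℝ → ℝ}
    (hv : ContDiff ℝ ∞ (fun q : ℝ × ℝ × ℝ => v q.1 q.2.1 q.2.2)) (t x y : ℝ) :
    HasDerivAt (fun y' => v t x y')
      (fderiv ℝ (fun q : ℝ × ℝ × ℝ => v q.1 q.2.1 q.2.2) (t, x, y) (0, 0, 1)) y :=
  ((hv.differentiable (by simp) (t, x, y)).hasFDerivAt.comp_hasDerivAt y
    ((hasDerivAt_const y t).prodMk ((hasDerivAt_const y x).prodMk (hasDerivAt_id y))) :)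

open scoped ContDiff in
theorem contDiff_fderiv_apply_const {E : Type*} [NormedAddCommGroup E] [NormedSpace ℝ E]
    {u : E → ℝ} (hu : ContDiff ℝ ∞ u) (e : E) : ContDiff ℝ ∞ (fun q => fderiv ℝ u q e) :=
  (hu.fderiv_right (m := ∞) (by simp)).clm_apply contDiff_const

open scoped ContDiff in
theorem contDiff_pdt {v : ℝ → ℝ → ℝ → ℝ}
    (hv : ContDiff ℝ ∞ (fun q : ℝ × ℝ × ℝ => v q.1 q.2.1 q.2.2)) :
    ContDiff ℝ ∞ (fun q : ℝ × ℝ × ℝ => pdt v q.1 q.2.1 q.2.2) := by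
  convert contDiff_fderiv_apply_const hv (1, 0, 0) using 2 with q
  exact (hasDerivAt_slice_fst hv q.1 q.2.1 q.2.2).deriv

open scoped ContDiff in
theorem contDiff_pdx {v : ℝ → ℝ → ℝ → ℝ}
    (hv : ContDiff ℝ ∞ (fun q : ℝ × ℝ × ℝ => v q.1 q.2.1 q.2.2)) :
    ContDiff ℝ ∞ (fun q : ℝ × ℝ × ℝ => pdx v q.1 q.2.1 q.2.2) := by
  convert contDiff_fderiv_apply_const hv (0, 1, 0) using 2 with q
  exact (hasDerivAt_slice_snd hv q.1 q.2.1 q.2.2).deriv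

open scoped ContDiff in
theorem contDiff_pdy {v : ℝ → ℝ → ℝ → ℝ}
    (hv : ContDiff ℝ ∞ (fun q : ℝ × ℝ × ℝ => v q.1 q.2.1 q.2.2)) :
    ContDiff ℝ ∞ (fun q : ℝ × ℝ × ℝ => pdy v q.1 q.2.1 q.2.2) := by
  convert contDiff_fderiv_apply_const hv (0, 0, 1) using 2 with q
  exact (hasDerivAt_slice_thd hv q.1 q.2.1 q.2.2).deriv

open scoped ContDiff in
theorem hasDerivAt_pdx {v : ℝ → ℝ → ℝ → ℝ}
    (hv : ContDiff ℝ ∞ (fun q : ℝ × ℝ × ℝ => v q.1 q.2.1 q.2.2)) (t x y : ℝ) :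
    HasDerivAt (fun x' => v t x' y) (pdx v t x y) x :=
  (hasDerivAt_slice_snd hv t x y).differentiableAt.hasDerivAt

open scoped ContDiff in
theorem hasDerivAt_pdy {v : ℝ → ℝ → ℝ → ℝ}
    (hv : ContDiff ℝ ∞ (fun q : ℝ × ℝ × ℝ => v q.1 q.2.1 q.2.2)) (t x y : ℝ) :
    HasDerivAt (fun y' => v t x y') (pdy v t x y) y :=
  (hasDerivAt_slice_thd hv t x y).differentiableAt.hasDerivAt

open scoped ContDiff in
theorem pdx_pdt_comm {v : ℝ → ℝ → ℝ → ℝ}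
    (hv : ContDiff ℝ ∞ (fun q : ℝ × ℝ × ℝ => v q.1 q.2.1 q.2.2)) (t x y : ℝ) :
    pdx (pdt v) t x y = pdt (pdx v) t x y := by
  have hd : DifferentiableAt ℝ (fderiv ℝ (fun q : ℝ × ℝ × ℝ => v q.1 q.2.1 q.2.2)) (t, x, y) :=
    (hv.fderiv_right (m := ∞) (by simp)).differentiable (by simp) _
  have hsymm : IsSymmSndFDerivAt ℝ (fun q : ℝ × ℝ × ℝ => v q.1 q.2.1 q.2.2) (t, x, y) :=
    hv.contDiffAt.isSymmSndFDerivAt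
      (by rw [minSmoothness_of_isRCLikeNormedField]; exact WithTop.coe_le_coe.2 (le_top (a := (2 : ℕ∞))))
  have ht : (fun q : ℝ × ℝ × ℝ => pdt v q.1 q.2.1 q.2.2) =
      fun q => fderiv ℝ (fun q : ℝ × ℝ × ℝ => v q.1 q.2.1 q.2.2) q (1, 0, 0) :=
    funext fun q => (hasDerivAt_slice_fst hv q.1 q.2.1 q.2.2).deriv
  have hx : (fun q : ℝ × ℝ × ℝ => pdx v q.1 q.2.1 q.2.2) =
      fun q => fderiv ℝ (fun q : ℝ × ℝ × ℝ => v q.1 q.2.1 q.2.2) q (0, 1, 0) :=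
    funext fun q => (hasDerivAt_slice_snd hv q.1 q.2.1 q.2.2).deriv
  refine (hasDerivAt_slice_snd (contDiff_pdt hv) t x y).deriv.trans
    (Eq.trans ?_ (hasDerivAt_slice_fst (contDiff_pdx hv) t x y).deriv.symm)
  rw [ht, hx, fderiv_clm_apply hd (differentiableAt_const _),
    fderiv_clm_apply hd (differentiableAt_const _)]
  simpa using hsymm (0, 1, 0) (1, 0, 0)

/-- Infinite family of topological-charge conservation laws of the gKP equation,
with multiplier `f₁(t)·y + f₂(t)`. -/
theorem gkp_topological_charge_conservation
    (s : ℝ) (hs : s = 1 ∨ s = -1)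
    (p : ℕ) (hp : 1 ≤ p)
    (f₁ f₂ : ℝ → ℝ)
    (hf₁ : ContDiff ℝ (⊤ : ℕ∞) f₁) (hf₂ : ContDiff ℝ (⊤ : ℕ∞) f₂)
    (v : ℝ → ℝ → ℝ → ℝ)
    (hv : ContDiff ℝ (⊤ : ℕ∞) (fun q : ℝ × ℝ × ℝ => v q.1 q.2.1 q.2.2))
    (hsol : ∀ t x y : ℝ,
      pdt (pdx v) t x y + (pdx v t x y) ^ p * pdx (pdx v) t x y
        + pdx (pdx (pdx (pdx v))) t x y + s * pdy (pdy v) t x y = 0)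
    (T X Y : ℝ → ℝ → ℝ → ℝ)
    (hT : ∀ t x y : ℝ, T t x y = 0)
    (hX : ∀ t x y : ℝ, X t x y =
      ((pdx v t x y) ^ (p+1) / ((p : ℝ) + 1) + pdx (pdx (pdx v)) t x y + pdt v t x y)
        * (f₁ t * y + f₂ t))
    (hY : ∀ t x y : ℝ, Y t x y =
      s * ((y * pdy v t x y - v t x y) * f₁ t + f₂ t * pdy v t x y)) :
    ∀ t x y : ℝ, pdt T t x y + pdx X t x y + pdy Y t x y = 0 := by
  intro t x y
  have hvx := contDiff_pdx hv
  have hT' : pdt T t x y = 0 := by simp [pdt, hT]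
  have hX' : pdx X t x y =
      (pdx v t x y ^ p * pdx (pdx v) t x y + pdx (pdx (pdx (pdx v))) t x y
        + pdx (pdt v) t x y) * (f₁ t * y + f₂ t) := by
    have h := (((((hasDerivAt_pdx hvx t x y).pow (p + 1)).div_const ((p : ℝ) + 1)).add
      (hasDerivAt_pdx (contDiff_pdx (contDiff_pdx hvx)) t x y)).add
      (hasDerivAt_pdx (contDiff_pdt hv) t x y)).mul_const (f₁ t * y + f₂ t)
    have hX₁ : (fun x' => X t x' y) = _ := funext fun x' => hX t x' y
    rw [pdx, hX₁]
    refine h.deriv.trans ?_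
    have hp₀ : (p : ℝ) + 1 ≠ 0 := by positivity
    push_cast
    field_simp
  have hY' : pdy Y t x y = s * pdy (pdy v) t x y * (f₁ t * y + f₂ t) := by
    have hvy := hasDerivAt_pdy (contDiff_pdy hv) t x y
    have h := (((((hasDerivAt_id y).mul hvy).sub (hasDerivAt_pdy hv t x y)).mul_const
      (f₁ t)).add (hvy.const_mul (f₂ t))).const_mul s
    have hY₁ : (fun y' => Y t x y') = _ := funext fun y' => hY t x y'
    rw [pdy, hY₁]
    refine h.deriv.trans ?_
    simp only [id]
    ring
  rw [hT', hX', hY', pdx_pdt_comm hv]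
  linear_combination (f₁ t * y + f₂ t) * hsol t x y
end

section
/- Let s ∈ {1,−1}, e ∈ {1,−1}, let p be a positive integer, and let v : ℝ³ → ℝ be a smooth function of (t,x,y) solving the 2D gB potential equation v_{tt} = v_{xx} + (p+1)(v_x)^p v_{xx} + e·v_{xxxx} + s·v_{yy} at every point. Define T = v_x·v_t, X = −((p+1)/(p+2))·v_x^{p+2} − e·(v_x·v_{xxx} − (1/2)v_{xx}²) + (1/2)s·v_y² − (1/2)v_t² − (1/2)v_x², Y = −s·v_y·v_x. Then ∂_t T + ∂_x X + ∂_y Y = 0 at every point (this is the x-momentum conservation law of the 2D generalized Boussinesq equation, arising from x-translation invariance). -/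
open scoped ContDiff

/-- Joint smoothness of a function of `(t, x, y)`. -/
def JointlySmooth (v : ℝ → ℝ → ℝ → ℝ) : Prop :=
  ContDiff ℝ ∞ (fun q : ℝ × ℝ × ℝ => v q.1 q.2.1 q.2.2)

namespace JointlySmooth

variable {v : ℝ → ℝ → ℝ → ℝ}

lemma hasFDerivAt (hv : JointlySmooth v) (q : ℝ × ℝ × ℝ) :
    HasFDerivAt (fun q : ℝ × ℝ × ℝ => v q.1 q.2.1 q.2.2)
      (fderiv ℝ (fun q : ℝ × ℝ × ℝ => v q.1 q.2.1 q.2.2) q) q :=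
  (hv.differentiable (by simp) q).hasFDerivAt

lemma hasDerivAt_t_fderiv (hv : JointlySmooth v) (t x y : ℝ) :
    HasDerivAt (fun t' => v t' x y)
      (fderiv ℝ (fun q : ℝ × ℝ × ℝ => v q.1 q.2.1 q.2.2) (t, x, y) (1, 0, 0)) t :=
  HasFDerivAt.comp_hasDerivAt (f := fun t' => (t', x, y)) t (hv.hasFDerivAt (t, x, y))
    ((hasDerivAt_id t).prodMk ((hasDerivAt_const t x).prodMk (hasDerivAt_const t y)))

lemma hasDerivAt_x_fderiv (hv : JointlySmooth v) (t x y : ℝ) :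
    HasDerivAt (fun x' => v t x' y)
      (fderiv ℝ (fun q : ℝ × ℝ × ℝ => v q.1 q.2.1 q.2.2) (t, x, y) (0, 1, 0)) x :=
  HasFDerivAt.comp_hasDerivAt (f := fun x' => (t, x', y)) x (hv.hasFDerivAt (t, x, y))
    ((hasDerivAt_const x t).prodMk ((hasDerivAt_id x).prodMk (hasDerivAt_const x y)))

lemma hasDerivAt_y_fderiv (hv : JointlySmooth v) (t x y : ℝ) :
    HasDerivAt (fun y' => v t x y')
      (fderiv ℝ (fun q : ℝ × ℝ × ℝ => v q.1 q.2.1 q.2.2) (t, x, y) (0, 0, 1)) y :=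
  HasFDerivAt.comp_hasDerivAt (f := fun y' => (t, x, y')) y (hv.hasFDerivAt (t, x, y))
    ((hasDerivAt_const y t).prodMk ((hasDerivAt_const y x).prodMk (hasDerivAt_id y)))

lemma pdt_eq (hv : JointlySmooth v) : pdt v = fun t x y =>
    fderiv ℝ (fun q : ℝ × ℝ × ℝ => v q.1 q.2.1 q.2.2) (t, x, y) (1, 0, 0) := by
  funext t x y
  exact (hv.hasDerivAt_t_fderiv t x y).deriv

lemma pdx_eq (hv : JointlySmooth v) : pdx v = fun t x y =>
    fderiv ℝ (fun q : ℝ × ℝ × ℝ => v q.1 q.2.1 q.2.2) (t, x, y) (0, 1, 0) := by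
  funext t x y
  exact (hv.hasDerivAt_x_fderiv t x y).deriv

lemma pdy_eq (hv : JointlySmooth v) : pdy v = fun t x y =>
    fderiv ℝ (fun q : ℝ × ℝ × ℝ => v q.1 q.2.1 q.2.2) (t, x, y) (0, 0, 1) := by
  funext t x y
  exact (hv.hasDerivAt_y_fderiv t x y).deriv

lemma contDiff_fderiv (hv : JointlySmooth v) :
    ContDiff ℝ ∞ (fderiv ℝ (fun q : ℝ × ℝ × ℝ => v q.1 q.2.1 q.2.2)) :=
  ContDiff.fderiv_right hv (by simp)

lemma fderiv_apply (hv : JointlySmooth v) (a : ℝ × ℝ × ℝ) :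
    JointlySmooth fun t x y =>
      fderiv ℝ (fun q : ℝ × ℝ × ℝ => v q.1 q.2.1 q.2.2) (t, x, y) a :=
  hv.contDiff_fderiv.clm_apply contDiff_const

lemma smooth_pdt (hv : JointlySmooth v) : JointlySmooth (pdt v) :=
  hv.pdt_eq ▸ hv.fderiv_apply _

lemma smooth_pdx (hv : JointlySmooth v) : JointlySmooth (pdx v) :=
  hv.pdx_eq ▸ hv.fderiv_apply _

lemma smooth_pdy (hv : JointlySmooth v) : JointlySmooth (pdy v) :=
  hv.pdy_eq ▸ hv.fderiv_apply _

lemma hasDerivAt_t (hv : JointlySmooth v) (t x y : ℝ) :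
    HasDerivAt (fun t' => v t' x y) (pdt v t x y) t :=
  (hv.hasDerivAt_t_fderiv t x y).differentiableAt.hasDerivAt

lemma hasDerivAt_x (hv : JointlySmooth v) (t x y : ℝ) :
    HasDerivAt (fun x' => v t x' y) (pdx v t x y) x :=
  (hv.hasDerivAt_x_fderiv t x y).differentiableAt.hasDerivAt

lemma hasDerivAt_y (hv : JointlySmooth v) (t x y : ℝ) :
    HasDerivAt (fun y' => v t x y') (pdy v t x y) y :=
  (hv.hasDerivAt_y_fderiv t x y).differentiableAt.hasDerivAt

/-- Mixed second directional derivatives commute. -/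
lemma fderiv_fderiv_comm (hv : JointlySmooth v) (q a b : ℝ × ℝ × ℝ) :
    fderiv ℝ (fun r : ℝ × ℝ × ℝ =>
        fderiv ℝ (fun q : ℝ × ℝ × ℝ => v q.1 q.2.1 q.2.2) r a) q b =
      fderiv ℝ (fun r : ℝ × ℝ × ℝ =>
        fderiv ℝ (fun q : ℝ × ℝ × ℝ => v q.1 q.2.1 q.2.2) r b) q a := by
  have hd := hv.contDiff_fderiv.differentiable (by simp) q
  have hsymm : IsSymmSndFDerivAt ℝ (fun q : ℝ × ℝ × ℝ => v q.1 q.2.1 q.2.2) q :=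
    ContDiffAt.isSymmSndFDerivAt (n := ∞) (ContDiff.contDiffAt hv)
      (by simpa using WithTop.coe_le_coe.2 (le_top (a := (2 : ℕ∞))))
  rw [fderiv_clm_apply hd (by fun_prop), fderiv_clm_apply hd (by fun_prop)]
  simpa using hsymm b a

lemma pdt_pdx_comm (hv : JointlySmooth v) :
    pdt (pdx v) = pdx (pdt v) := by
  rw [hv.smooth_pdx.pdt_eq, hv.smooth_pdt.pdx_eq, hv.pdx_eq, hv.pdt_eq]
  funext t x y
  exact hv.fderiv_fderiv_comm _ _ _

lemma pdy_pdx_comm (hv : JointlySmooth v) :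
    pdy (pdx v) = pdx (pdy v) := by
  rw [hv.smooth_pdx.pdy_eq, hv.smooth_pdy.pdx_eq, hv.pdx_eq, hv.pdy_eq]
  funext t x y
  exact hv.fderiv_fderiv_comm _ _ _

end JointlySmooth

/-- x-momentum conservation law of the 2D generalized Boussinesq equation. -/
theorem gb_x_momentum_conservation
    (s : ℝ) (hs : s = 1 ∨ s = -1)
    (e : ℝ) (he : e = 1 ∨ e = -1)
    (p : ℕ) (hp : 1 ≤ p)
    (v : ℝ → ℝ → ℝ → ℝ)
    (hv : ContDiff ℝ (⊤ : ℕ∞) (fun q : ℝ × ℝ × ℝ => v q.1 q.2.1 q.2.2))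
    (hsol : ∀ t x y : ℝ,
      pdt (pdt v) t x y = pdx (pdx v) t x y
        + ((p : ℝ) + 1) * (pdx v t x y) ^ p * pdx (pdx v) t x y
        + e * pdx (pdx (pdx (pdx v))) t x y + s * pdy (pdy v) t x y)
    (T X Y : ℝ → ℝ → ℝ → ℝ)
    (hT : ∀ t x y : ℝ, T t x y = pdx v t x y * pdt v t x y)
    (hX : ∀ t x y : ℝ, X t x y =
      -(((p : ℝ) + 1) / ((p : ℝ) + 2)) * (pdx v t x y) ^ (p+2)
        - e * (pdx v t x y * pdx (pdx (pdx v)) t x y - (1/2) * (pdx (pdx v) t x y) ^ 2)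
        + (1/2) * s * (pdy v t x y) ^ 2 - (1/2) * (pdt v t x y) ^ 2
        - (1/2) * (pdx v t x y) ^ 2)
    (hY : ∀ t x y : ℝ, Y t x y = - s * pdy v t x y * pdx v t x y) :
    ∀ t x y : ℝ, pdt T t x y + pdx X t x y + pdy Y t x y = 0 := by
  intro t x y
  have hv : JointlySmooth v := hv
  have dT : pdt T t x y =
      pdt (pdx v) t x y * pdt v t x y + pdx v t x y * pdt (pdt v) t x y := by
    simp only [pdt.eq_1 T, hT]
    exact ((hv.smooth_pdx.hasDerivAt_t t x y).mul (hv.smooth_pdt.hasDerivAt_t t x y)).deriv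
  have dY : pdy Y t x y =
      -s * pdy (pdy v) t x y * pdx v t x y + -s * pdy v t x y * pdy (pdx v) t x y := by
    simp only [pdy.eq_1 Y, hY]
    exact (((hv.smooth_pdy.hasDerivAt_y t x y).const_mul (-s)).mul (hv.smooth_pdx.hasDerivAt_y t x y)).deriv
  have dX : pdx X t x y =
      -((p : ℝ) + 1) * pdx v t x y ^ (p + 1) * pdx (pdx v) t x y
        - e * (pdx v t x y * pdx (pdx (pdx (pdx v))) t x y)
        + s * pdy v t x y * pdx (pdy v) t x y - pdt v t x y * pdx (pdt v) t x y
        - pdx v t x y * pdx (pdx v) t x y := by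
    have h1 := hv.smooth_pdx.hasDerivAt_x t x y
    have h2 := hv.smooth_pdx.smooth_pdx.hasDerivAt_x t x y
    have h3 := hv.smooth_pdx.smooth_pdx.smooth_pdx.hasDerivAt_x t x y
    have hy := hv.smooth_pdy.hasDerivAt_x t x y
    have ht := hv.smooth_pdt.hasDerivAt_x t x y
    simp only [pdx.eq_1 X, hX]
    refine ((((((h1.pow (p + 2)).const_mul (-(((p : ℝ) + 1) / ((p : ℝ) + 2)))).sub
      (((h1.mul h3).sub ((h2.pow 2).const_mul (1 / 2))).const_mul e)).add
      ((hy.pow 2).const_mul (1 / 2 * s))).sub ((ht.pow 2).const_mul (1 / 2))).sub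
      ((h1.pow 2).const_mul (1 / 2))).deriv.trans ?_
    have hp2 : (p : ℝ) + 2 ≠ 0 := by positivity
    simp only [Nat.add_succ_sub_one]
    push_cast
    field_simp
    ring
  rw [dT, dX, dY, hsol, hv.pdt_pdx_comm, hv.pdy_pdx_comm]
  ring
end

section
/- Let s ∈ {1,−1}, e ∈ {1,−1}, let ε ∈ ℝ, and let v : ℝ³ → ℝ be a smooth function of (t,x,y) solving the 2D gB potential equation with nonlinearity power p = 1, i.e. v_{tt} = v_{xx} + 2·v_x·v_{xx} + e·v_{xxxx} + s·v_{yy}, at every point. Then the function ṽ(t,x,y) := exp(−ε)·v(exp(−2ε)·t, exp(−ε)·x, exp(−2ε)·y) + (1/2)(exp(−2ε) − 1)·x also solves this equation at every point. (This is the one-parameter scaling-shift symmetry group, with infinitesimal generator τ = 2t, ξ^x = x, ξ^y = 2y, η = −(v+x), admitted by the 2D generalized Boussinesq equation only for p = 1.) -/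
theorem pdt_scale (u : ℝ → ℝ → ℝ → ℝ) (a k b c d : ℝ) :
    pdt (fun t x y => a * u (b * t) (c * x) (d * y) + k * x) =
      fun t x y => a * b * pdt u (b * t) (c * x) (d * y) := by
  funext t x y
  have h := deriv_comp_mul_left b (fun t' => u t' (c * x) (d * y)) t
  simp only [smul_eq_mul] at h
  simp only [pdt, deriv_add_const, deriv_const_mul_field, h, mul_assoc]

theorem pdy_scale (u : ℝ → ℝ → ℝ → ℝ) (a k b c d : ℝ) :
    pdy (fun t x y => a * u (b * t) (c * x) (d * y) + k * x) =
      fun t x y => a * d * pdy u (b * t) (c * x) (d * y) := by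
  funext t x y
  have h := deriv_comp_mul_left d (fun y' => u (b * t) (c * x) y') y
  simp only [smul_eq_mul] at h
  simp only [pdy, deriv_add_const, deriv_const_mul_field, h, mul_assoc]

theorem pdx_scale_add_const (u : ℝ → ℝ → ℝ → ℝ) (a k b c d : ℝ) :
    pdx (fun t x y => a * u (b * t) (c * x) (d * y) + k) =
      fun t x y => a * c * pdx u (b * t) (c * x) (d * y) := by
  funext t x y
  have h := deriv_comp_mul_left c (fun x' => u (b * t) x' (d * y)) x
  simp only [smul_eq_mul] at h
  simp only [pdx, deriv_add_const, deriv_const_mul_field, h, mul_assoc]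

theorem pdx_scale_add_linear (u : ℝ → ℝ → ℝ → ℝ)
    (hu : ∀ t y, Differentiable ℝ fun x => u t x y) (a k b c d : ℝ) :
    pdx (fun t x y => a * u (b * t) (c * x) (d * y) + k * x) =
      fun t x y => a * c * pdx u (b * t) (c * x) (d * y) + k := by
  funext t x y
  have hc : HasDerivAt (fun x' => c * x') c x := by
    simpa using (hasDerivAt_id x).const_mul c
  have h := (((hu (b * t) (d * y) (c * x)).hasDerivAt.comp x hc).const_mul a).add
    ((hasDerivAt_id x).const_mul k)
  refine h.deriv.trans ?_
  simp only [pdx]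
  ring

/-- One-parameter scaling-shift symmetry group of the 2D generalized
Boussinesq equation with nonlinearity power `p = 1`. -/
theorem gb_scaling_shift_symmetry
    (s : ℝ) (hs : s = 1 ∨ s = -1)
    (e : ℝ) (he : e = 1 ∨ e = -1)
    (ε : ℝ)
    (v : ℝ → ℝ → ℝ → ℝ)
    (hv : ContDiff ℝ (⊤ : ℕ∞) (fun q : ℝ × ℝ × ℝ => v q.1 q.2.1 q.2.2))
    (hsol : ∀ t x y : ℝ,
      pdt (pdt v) t x y = pdx (pdx v) t x y
        + 2 * pdx v t x y * pdx (pdx v) t x y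
        + e * pdx (pdx (pdx (pdx v))) t x y + s * pdy (pdy v) t x y)
    (w : ℝ → ℝ → ℝ → ℝ)
    (hw : ∀ t x y : ℝ, w t x y =
      Real.exp (-ε) * v (Real.exp (-(2*ε)) * t) (Real.exp (-ε) * x) (Real.exp (-(2*ε)) * y)
        + (1/2) * (Real.exp (-(2*ε)) - 1) * x) :
    ∀ t x y : ℝ,
      pdt (pdt w) t x y = pdx (pdx w) t x y
        + 2 * pdx w t x y * pdx (pdx w) t x y
        + e * pdx (pdx (pdx (pdx w))) t x y + s * pdy (pdy w) t x y := by
  have hdiff : ∀ t y, Differentiable ℝ fun x => v t x y := fun t y =>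
    (hv.differentiable (by simp)).comp
      (g := fun q : ℝ × ℝ × ℝ => v q.1 q.2.1 q.2.2) (f := fun x : ℝ => (t, x, y))
      (by fun_prop)
  have hsq : Real.exp (-(2 * ε)) = Real.exp (-ε) ^ 2 := by
    rw [← Real.exp_nat_mul]
    congr 1
    push_cast
    ring
  rw [hsq] at hw
  generalize Real.exp (-ε) = l at hw
  obtain rfl : w = fun t x y =>
      l * v (l ^ 2 * t) (l * x) (l ^ 2 * y) + (1 / 2) * (l ^ 2 - 1) * x := by
    funext t x y
    exact hw t x y
  have ht := fun u a => pdt_scale u a 0 (l ^ 2) l (l ^ 2)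
  have hy := fun u a => pdy_scale u a 0 (l ^ 2) l (l ^ 2)
  have hx := fun u a => pdx_scale_add_const u a 0 (l ^ 2) l (l ^ 2)
  simp only [zero_mul, add_zero] at ht hy hx
  intro t x y
  rw [pdt_scale, pdy_scale, pdx_scale_add_linear v hdiff, ht, hy, pdx_scale_add_const, hx, hx]
  linear_combination l ^ 5 * hsol (l ^ 2 * t) (l * x) (l ^ 2 * y)
end

section
/- Let s ∈ {1,−1}, let p > 0 be a real number, and let μ, ν ∈ ℝ satisfy κ := ν² − s·μ² − 1 > 0. Define U : ℝ → ℝ by U(ξ) := ((1/2)(p+2)·κ)^{1/p} · (sech((p/2)·√κ·ξ))^{2/p}, where sech(z) = 2/(e^z + e^{−z}) and the powers are real powers of positive real numbers. Then: (i) U is smooth, positive, and U(ξ) → 0 as ξ → +∞ and as ξ → −∞; (ii) U satisfies the first-order ODE U′(ξ)² = κ·U(ξ)² − (2/(p+2))·U(ξ)^{p+2} for all ξ ∈ ℝ; and (iii) the line travelling wave u(t,x,y) := U(x + μ·y − ν·t) satisfies the 2D generalized Boussinesq equation with the '+' sign of the fourth-order term, i.e. u_{tt} = u_{xx} + ∂_x∂_x(u^{p+1})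 + u_{xxxx} + s·u_{yy} at every point of ℝ³, where u^{p+1} denotes the real power (well-defined since u > 0). This is the line soliton solution of the '+' case of the 2D gB equation for every nonlinearity power p > 0, with direction and speed parameters μ, ν obeying the kinematic condition ν² > s·μ² + 1. -/
/-- The hyperbolic secant. -/
noncomputable def sech (z : ℝ) : ℝ := 2 / (Real.exp z + Real.exp (-z))

theorem sech_eq_inv_cosh (z : ℝ) : sech z = (Real.cosh z)⁻¹ := by
  rw [sech, Real.cosh_eq, inv_div]

theorem sech_pos (z : ℝ) : 0 < sech z := by
  rw [sech_eq_inv_cosh]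
  exact inv_pos.2 (Real.cosh_pos z)

theorem contDiff_sech {n : WithTop ℕ∞} : ContDiff ℝ n sech := by
  rw [show sech = fun z => (Real.cosh z)⁻¹ from funext sech_eq_inv_cosh]
  exact Real.contDiff_cosh.inv fun z => (Real.cosh_pos z).ne'

theorem hasDerivAt_sech (z : ℝ) : HasDerivAt sech (-(Real.tanh z * sech z)) z := by
  rw [show sech = fun z => (Real.cosh z)⁻¹ from funext sech_eq_inv_cosh]
  refine ((Real.hasDerivAt_cosh z).fun_inv (Real.cosh_pos z).ne').congr_deriv ?_
  have := (Real.cosh_pos z).ne'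
  rw [Real.tanh_eq_sinh_div_cosh]
  field_simp

theorem tanh_sq_add_sech_sq (z : ℝ) : Real.tanh z ^ 2 + sech z ^ 2 = 1 := by
  have := (Real.cosh_pos z).ne'
  rw [Real.tanh_eq_sinh_div_cosh, sech_eq_inv_cosh]
  field_simp
  linarith [Real.cosh_sq z]

theorem hasDerivAt_tanh (z : ℝ) : HasDerivAt Real.tanh (sech z ^ 2) z := by
  rw [show Real.tanh = fun z => Real.sinh z / Real.cosh z from
    funext Real.tanh_eq_sinh_div_cosh]
  have hc := (Real.cosh_pos z).ne'
  refine ((Real.hasDerivAt_sinh z).fun_div (Real.hasDerivAt_cosh z) hc).congr_deriv ?_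
  rw [sech_eq_inv_cosh]
  field_simp
  linarith [Real.cosh_sq z]

theorem sech_neg (z : ℝ) : sech (-z) = sech z := by
  rw [sech_eq_inv_cosh, sech_eq_inv_cosh, Real.cosh_neg]

theorem tendsto_sech_atTop : Filter.Tendsto sech Filter.atTop (nhds 0) := by
  refine Filter.Tendsto.const_div_atTop ?_ 2
  exact Filter.tendsto_atTop_mono (fun z => by linarith [Real.exp_pos (-z)]) Real.tendsto_exp_atTop

theorem tendsto_sech_atBot : Filter.Tendsto sech Filter.atBot (nhds 0) := by
  rw [← show (fun z => sech (-z)) = sech from funext sech_neg]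
  exact tendsto_sech_atTop.comp Filter.tendsto_neg_atBot_atTop

theorem pdt_travelling_wave (F : ℝ → ℝ) (μ ν : ℝ) :
    pdt (fun t x y => F (x + μ * y - ν * t))
      = fun t x y => -ν * deriv F (x + μ * y - ν * t) := by
  funext t x y
  have h := deriv_comp_mul_left ν (fun w => F (x + μ * y - w)) t
  rw [deriv_comp_const_sub] at h
  simpa [pdt] using h

theorem pdx_travelling_wave (F : ℝ → ℝ) (μ ν : ℝ) :
    pdx (fun t x y => F (x + μ * y - ν * t))
      = fun t x y => deriv F (x + μ * y - ν * t) := by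
  funext t x y
  have h := deriv_comp_add_const F (μ * y - ν * t) x
  simpa [pdx, add_sub_assoc] using h

theorem pdy_travelling_wave (F : ℝ → ℝ) (μ ν : ℝ) :
    pdy (fun t x y => F (x + μ * y - ν * t))
      = fun t x y => μ * deriv F (x + μ * y - ν * t) := by
  funext t x y
  have h := deriv_comp_mul_left μ (fun w => F (w + (x - ν * t))) y
  rw [deriv_comp_add_const] at h
  have e : ∀ w, μ * w + (x - ν * t) = x + μ * w - ν * t := fun w => by ring
  simpa [pdy, e] using h

theorem pdt_pdt_travelling_wave (F : ℝ → ℝ) (μ ν : ℝ) :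
    pdt (pdt fun t x y => F (x + μ * y - ν * t))
      = fun t x y => ν ^ 2 * deriv (deriv F) (x + μ * y - ν * t) := by
  rw [pdt_travelling_wave, pdt_travelling_wave (fun w => -ν * deriv F w)]
  funext t x y
  rw [deriv_const_mul_field]
  ring

theorem pdy_pdy_travelling_wave (F : ℝ → ℝ) (μ ν : ℝ) :
    pdy (pdy fun t x y => F (x + μ * y - ν * t))
      = fun t x y => μ ^ 2 * deriv (deriv F) (x + μ * y - ν * t) := by
  rw [pdy_travelling_wave, pdy_travelling_wave (fun w => μ * deriv F w)]
  funext t x y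
  rw [deriv_const_mul_field]
  ring

/-- A profile satisfying the twice-integrated travelling wave equation gives a solution of the
2D generalized Boussinesq equation. -/
theorem travelling_wave_solves_gb {s p μ ν κ : ℝ} (hκ : κ = ν ^ 2 - s * μ ^ 2 - 1)
    {U : ℝ → ℝ} (hU : ContDiff ℝ (⊤ : ℕ∞) U)
    (hU'' : ∀ ξ, deriv (deriv U) ξ = κ * U ξ - U ξ ^ (p + 1)) (t x y : ℝ) :
    pdt (pdt fun t x y => U (x + μ * y - ν * t)) t x y
      = pdx (pdx fun t x y => U (x + μ * y - ν * t)) t x y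
        + pdx (pdx fun t x y => U (x + μ * y - ν * t) ^ (p + 1)) t x y
        + pdx (pdx (pdx (pdx fun t x y => U (x + μ * y - ν * t)))) t x y
        + s * pdy (pdy fun t x y => U (x + μ * y - ν * t)) t x y := by
  have deriv_smooth : ∀ {f : ℝ → ℝ}, ContDiff ℝ (⊤ : ℕ∞) f → ContDiff ℝ (⊤ : ℕ∞) (deriv f) :=
    fun h => (contDiff_infty_iff_deriv.1 h).2
  have diff : ∀ {f : ℝ → ℝ}, ContDiff ℝ (⊤ : ℕ∞) f → Differentiable ℝ f :=
    fun h => (contDiff_infty_iff_deriv.1 h).1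
  have hU1 := deriv_smooth hU
  have hU2 := deriv_smooth hU1
  have hU3 := deriv_smooth hU2
  have hW : (fun ξ => U ξ ^ (p + 1)) = fun ξ => κ * U ξ - deriv (deriv U) ξ := by
    funext ξ
    rw [hU'']
    ring
  have hW1 : deriv (fun ξ => U ξ ^ (p + 1))
      = fun ξ => κ * deriv U ξ - deriv (deriv (deriv U)) ξ := by
    funext ξ
    rw [hW, deriv_fun_sub ((diff hU ξ).const_mul κ) (diff hU2 ξ), deriv_const_mul_field]
  have hW2 : deriv (deriv fun ξ => U ξ ^ (p + 1))
      = fun ξ => κ * deriv (deriv U) ξ - deriv (deriv (deriv (deriv U))) ξ := by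
    funext ξ
    rw [hW1, deriv_fun_sub ((diff hU1 ξ).const_mul κ) (diff hU3 ξ), deriv_const_mul_field]
  rw [pdt_pdt_travelling_wave, pdy_pdy_travelling_wave, pdx_travelling_wave U,
    pdx_travelling_wave (deriv U), pdx_travelling_wave (fun ξ => U ξ ^ (p + 1)),
    pdx_travelling_wave (deriv fun ξ => U ξ ^ (p + 1)), pdx_travelling_wave (deriv (deriv U)),
    pdx_travelling_wave (deriv (deriv (deriv U))), hW2]
  subst hκ
  ring

/-- The line soliton solution of the '+' case of the 2D generalized
Boussinesq equation for every nonlinearity power `p > 0`,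
with kinematic condition `ν² > s·μ² + 1`. -/
theorem gb_line_soliton
    (s : ℝ) (hs : s = 1 ∨ s = -1)
    (p : ℝ) (hp : 0 < p)
    (μ ν κ : ℝ) (hκdef : κ = ν ^ 2 - s * μ ^ 2 - 1) (hκ : 0 < κ)
    (U : ℝ → ℝ)
    (hUdef : ∀ ξ : ℝ, U ξ =
      ((1/2) * (p+2) * κ) ^ (1/p)
        * (sech ((p/2) * Real.sqrt κ * ξ)) ^ (2/p))
    (u : ℝ → ℝ → ℝ → ℝ)
    (hu : ∀ t x y : ℝ, u t x y = U (x + μ * y - ν * t)) :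
    -- (i) smooth, positive, decaying at ±∞
    (ContDiff ℝ (⊤ : ℕ∞) U ∧ (∀ ξ : ℝ, 0 < U ξ)
      ∧ Filter.Tendsto U Filter.atTop (nhds 0)
      ∧ Filter.Tendsto U Filter.atBot (nhds 0))
    -- (ii) first-order ODE
    ∧ (∀ ξ : ℝ, (deriv U ξ) ^ 2
        = κ * (U ξ) ^ 2 - (2 / (p+2)) * (U ξ) ^ (p+2))
    -- (iii) the line travelling wave solves the '+' case of the 2D gB equation
    ∧ (∀ t x y : ℝ,
        pdt (pdt u) t x y = pdx (pdx u) t x y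
          + pdx (pdx (fun t x y => (u t x y) ^ (p+1))) t x y
          + pdx (pdx (pdx (pdx u))) t x y + s * pdy (pdy u) t x y) := by
  obtain rfl : u = fun t x y => U (x + μ * y - ν * t) := by
    funext t x y
    exact hu t x y
  set C : ℝ := (1/2) * (p+2) * κ with hC
  have hCpos : 0 < C := by positivity
  set k : ℝ := (p/2) * Real.sqrt κ with hk
  have hkpos : 0 < k := by positivity
  have hsqrt : Real.sqrt κ ^ 2 = κ := Real.sq_sqrt hκ.le
  have hUfun : U = fun ξ => C ^ (1/p) * sech (k * ξ) ^ (2/p) := funext hUdef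
  have hUpos : ∀ ξ, 0 < U ξ := fun ξ => by
    rw [hUdef]
    exact mul_pos (Real.rpow_pos_of_pos hCpos _) (Real.rpow_pos_of_pos (sech_pos _) _)
  have hUsmooth : ContDiff ℝ (⊤ : ℕ∞) U := by
    rw [hUfun]
    exact contDiff_const.mul ((contDiff_sech.comp (contDiff_const.mul contDiff_id)).rpow_const_of_ne
      fun ξ => (sech_pos _).ne')
  have hlim : ∀ l : Filter ℝ, Filter.Tendsto (fun ξ => sech (k * ξ)) l (nhds 0) →
      Filter.Tendsto U l (nhds 0) := fun l h => by
    rw [hUfun]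
    have h2p : 0 < 2 / p := by positivity
    have := (h.rpow_const (Or.inr h2p.le)).const_mul (C ^ (1/p))
    rwa [Real.zero_rpow h2p.ne', mul_zero] at this
  have hUp : ∀ ξ, U ξ ^ p = C * sech (k * ξ) ^ 2 := fun ξ => by
    rw [hUdef, Real.mul_rpow (Real.rpow_nonneg hCpos.le _) (Real.rpow_nonneg (sech_pos _).le _),
      ← Real.rpow_mul hCpos.le, ← Real.rpow_mul (sech_pos _).le, one_div_mul_cancel hp.ne',
      div_mul_cancel₀ _ hp.ne', Real.rpow_one, Real.rpow_two]
  have hlin : ∀ ξ, HasDerivAt (fun w => k * w) k ξ := fun ξ => by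
    simpa using (hasDerivAt_id ξ).const_mul k
  have hU1 : ∀ ξ, HasDerivAt U (-(Real.sqrt κ * (Real.tanh (k * ξ) * U ξ))) ξ := fun ξ => by
    have h := ((((hasDerivAt_sech (k * ξ)).comp ξ (hlin ξ)).rpow_const (p := 2/p)
      (Or.inl (sech_pos _).ne')).const_mul (C ^ (1/p)))
    rw [hUfun]
    refine h.congr_deriv ?_
    simp only [Function.comp_apply]
    rw [Real.rpow_sub_one (sech_pos _).ne']
    have hsech := (sech_pos (k * ξ)).ne'
    have hkp : k * (2 / p) = Real.sqrt κ := by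
      rw [hk]
      field_simp
    rw [← hkp]
    field_simp
  have hdU : deriv U = fun ξ => -(Real.sqrt κ * (Real.tanh (k * ξ) * U ξ)) :=
    funext fun ξ => (hU1 ξ).deriv
  have hU2 : ∀ ξ, deriv (deriv U) ξ = κ * U ξ - U ξ ^ (p + 1) := fun ξ => by
    have h := ((((hasDerivAt_tanh (k * ξ)).comp ξ (hlin ξ)).mul (hU1 ξ)).const_mul
      (Real.sqrt κ)).neg
    rw [hdU]
    refine h.deriv.trans ?_
    simp only [Function.comp_apply]
    rw [Real.rpow_add_one (hUpos ξ).ne', hUp, hC, hk]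
    linear_combination (U ξ * Real.tanh (p / 2 * Real.sqrt κ * ξ) ^ 2
      - p / 2 * sech (p / 2 * Real.sqrt κ * ξ) ^ 2 * U ξ) * hsqrt
      + κ * U ξ * tanh_sq_add_sech_sq (p / 2 * Real.sqrt κ * ξ)
  refine ⟨⟨hUsmooth, hUpos,
      hlim _ (tendsto_sech_atTop.comp (Filter.tendsto_id.const_mul_atTop hkpos)),
      hlim _ (tendsto_sech_atBot.comp (Filter.tendsto_id.const_mul_atBot hkpos))⟩,
    fun ξ => ?_, travelling_wave_solves_gb hκdef hUsmooth hU2⟩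
  rw [hdU, Real.rpow_add (hUpos ξ), hUp, Real.rpow_two, hC]
  have : 2 / (p + 2) * (1 / 2 * (p + 2) * κ * sech (k * ξ) ^ 2 * U ξ ^ 2)
      = κ * sech (k * ξ) ^ 2 * U ξ ^ 2 := by
    field_simp
  rw [this]
  linear_combination (Real.tanh (k * ξ) * U ξ) ^ 2 * hsqrt
    + κ * U ξ ^ 2 * tanh_sq_add_sech_sq (k * ξ)
end
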